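/- Assume W is a double-well potential (W ∈ C¹(ℝ), W(-1) = W(1) = 0, W(s) > 0 for s ≠ ±1) and a : ℝ → ℝ satisfies 0 < a₁ ≤ a(t) ≤ a₂ for all t ∈ ℝ and is T-periodic for some T > 0. Then L_a attains its infimum at some u_a ∈ X₁; moreover, u_a is a C¹ ∩ W^{2,2}_loc solution of (u'/√(1 − |u'|²))' = a(t) W'(u) on ℝ with lim_{t→±∞}(u(t), u'(t)) = (±1, 0), and ‖u_a'‖_{L^∞(ℝ)} < 1. -/

import Mathlib

open MeasureTheory Filter Topology Set
open scoped ENNReal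

noncomputable section

/-- The class `X₁`: `W^{1,∞}(ℝ)` functions with `‖u'‖_{L^∞} ≤ 1` and `u(t) → ±1` as
`t → ±∞`. -/
def memX1 (u : ℝ → ℝ) : Prop :=
  LipschitzWith 1 u ∧ Tendsto u atTop (𝓝 (1:ℝ)) ∧ Tendsto u atBot (𝓝 (-1:ℝ))

/-- `W` is a double-well potential: `C¹`, vanishing exactly at `±1` and positive elsewhere. -/
def DoubleWell (W : ℝ → ℝ) : Prop :=
  ContDiff ℝ 1 W ∧ W (-1) = 0 ∧ W 1 = 0 ∧ ∀ s : ℝ, s ≠ -1 → s ≠ 1 → 0 < W s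

/-- The action functional `L_a(u) = ∫_ℝ (1 - √(1 - |u'|²) + a(t) W(u)) dt`. -/
def LaE (a W u : ℝ → ℝ) : ℝ≥0∞ :=
  ∫⁻ t : ℝ, ENNReal.ofReal (1 - Real.sqrt (1 - (deriv u t) ^ 2) + a t * W (u t))

/-- `u` is a `C¹ ∩ W^{2,2}_loc` solution of `(u'/√(1-|u'|²))' = a(t) W'(u)` on `ℝ`,
expressed through the integrated form of the equation. -/
def SolvesEL (a W u : ℝ → ℝ) : Prop :=
  ContDiff ℝ 1 u ∧
  ∀ s t : ℝ,
    deriv u t / Real.sqrt (1 - (deriv u t) ^ 2)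
      - deriv u s / Real.sqrt (1 - (deriv u s) ^ 2)
    = ∫ r in s..t, a r * deriv W (u r)

/-- The kinetic part `1 - √(1 - p²)` of the Lagrangian. -/
def kinetic (p : ℝ) : ℝ := 1 - Real.sqrt (1 - p ^ 2)

/-- The integrand of the action functional. -/
def actionDensity (a W u : ℝ → ℝ) (t : ℝ) : ℝ≥0∞ :=
  ENNReal.ofReal (1 - Real.sqrt (1 - (deriv u t) ^ 2) + a t * W (u t))

lemma LaE_eq (a W u : ℝ → ℝ) : LaE a W u = ∫⁻ t, actionDensity a W u t := rfl

lemma kinetic_nonneg (p : ℝ) : 0 ≤ kinetic p := by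
  unfold kinetic
  have : Real.sqrt (1 - p ^ 2) ≤ 1 := Real.sqrt_le_one.mpr (by nlinarith [sq_nonneg p])
  linarith

lemma kinetic_le_one (p : ℝ) : kinetic p ≤ 1 := by
  unfold kinetic
  linarith [Real.sqrt_nonneg (1 - p ^ 2)]

lemma continuous_kinetic : Continuous kinetic := by
  unfold kinetic; fun_prop

/-- Cauchy-Schwarz form of the Fenchel inequality for `kinetic`. -/
lemma mul_add_sqrt_one_sub_sq_le (P q : ℝ) (hq : |q| ≤ 1) :
    P * q + Real.sqrt (1 - q ^ 2) ≤ Real.sqrt (1 + P ^ 2) := by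
  have hq2 : 0 ≤ 1 - q ^ 2 := by nlinarith [abs_le.mp hq]
  apply Real.le_sqrt_of_sq_le
  nlinarith [Real.sq_sqrt hq2, sq_nonneg (q - P * Real.sqrt (1 - q ^ 2))]

/-- The inverse `x ↦ x / √(1 + x²)` of the momentum map `p ↦ p / √(1 - p²)`. -/
def velocity (x : ℝ) : ℝ := x / Real.sqrt (1 + x ^ 2)

lemma sqrt_one_add_sq_pos (x : ℝ) : 0 < Real.sqrt (1 + x ^ 2) :=
  Real.sqrt_pos.mpr (by positivity)

lemma one_sub_velocity_sq (x : ℝ) :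
    1 - velocity x ^ 2 = (Real.sqrt (1 + x ^ 2))⁻¹ ^ 2 := by
  unfold velocity
  have h : 0 < 1 + x ^ 2 := by positivity
  rw [div_pow, inv_pow, Real.sq_sqrt h.le]
  field_simp
  ring

lemma sqrt_one_sub_velocity_sq (x : ℝ) :
    Real.sqrt (1 - velocity x ^ 2) = (Real.sqrt (1 + x ^ 2))⁻¹ := by
  rw [one_sub_velocity_sq, Real.sqrt_sq (by positivity)]

lemma velocity_div_sqrt (x : ℝ) : velocity x / Real.sqrt (1 - velocity x ^ 2) = x := by
  rw [sqrt_one_sub_velocity_sq, velocity, div_inv_eq_mul,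
    div_mul_cancel₀ _ (sqrt_one_add_sq_pos x).ne']

lemma abs_velocity_lt_one (x : ℝ) : |velocity x| < 1 := by
  rw [← sq_lt_one_iff_abs_lt_one]
  have h := one_sub_velocity_sq x
  have : 0 < (Real.sqrt (1 + x ^ 2))⁻¹ ^ 2 := by
    have := sqrt_one_add_sq_pos x
    positivity
  linarith

lemma continuous_velocity : Continuous velocity := by
  unfold velocity
  exact continuous_id.div (by fun_prop) fun x => (sqrt_one_add_sq_pos x).ne'

lemma velocity_neg (x : ℝ) : velocity (-x) = -velocity x := by
  simp [velocity, neg_div]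

lemma kinetic_velocity (P : ℝ) :
    kinetic (velocity P) = 1 + P * velocity P - Real.sqrt (1 + P ^ 2) := by
  rw [kinetic, sqrt_one_sub_velocity_sq, velocity]
  have h := sqrt_one_add_sq_pos P
  field_simp
  rw [Real.sq_sqrt (by positivity)]
  ring

/-- The supporting line inequality for `kinetic` at `velocity P`. -/
lemma kinetic_velocity_add_le (P q : ℝ) (hq : |q| ≤ 1) :
    kinetic (velocity P) + P * (q - velocity P) ≤ kinetic q := by
  rw [kinetic_velocity, kinetic]
  linarith [mul_add_sqrt_one_sub_sq_le P q hq]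

lemma eq_velocity_of_kinetic_eq (P q : ℝ) (hq : |q| ≤ 1)
    (h : kinetic q = kinetic (velocity P) + P * (q - velocity P)) : q = velocity P := by
  rw [kinetic_velocity, kinetic] at h
  have hq2 : 0 ≤ 1 - q ^ 2 := by nlinarith [abs_le.mp hq]
  set s := Real.sqrt (1 - q ^ 2) with hs
  have hs2 : s ^ 2 = 1 - q ^ 2 := Real.sq_sqrt hq2
  have hr := sqrt_one_add_sq_pos P
  have hr2 : Real.sqrt (1 + P ^ 2) ^ 2 = 1 + P ^ 2 := Real.sq_sqrt (by positivity)
  set r := Real.sqrt (1 + P ^ 2) with hr'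
  have h1 : r = P * q + s := by linarith
  have h2 : (q - P * s) ^ 2 = 0 := by
    rw [h1] at hr2
    nlinarith
  have h3 : q - P * s = 0 := by simpa using h2
  rw [velocity, ← hr', eq_div_iff hr.ne', h1]
  have hqs : q = P * s := by linarith
  have hs3 : s ^ 2 + (P * s) ^ 2 = 1 := by rw [← hqs]; linarith
  linear_combination (P * q + s + P ^ 2 * s) * hqs + P * hs3

lemma velocity_monotone : Monotone velocity := by
  intro x y hxy
  have hx := kinetic_velocity_add_le x (velocity y) (abs_velocity_lt_one y).le
  have hy := kinetic_velocity_add_le y (velocity x) (abs_velocity_lt_one x).le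
  rcases hxy.eq_or_lt with rfl | hlt
  · exact le_rfl
  · by_contra hc
    push Not at hc
    nlinarith [mul_pos (sub_pos.mpr hlt) (sub_pos.mpr hc)]

lemma one_half_le_velocity_one : 1 / 2 ≤ velocity 1 := by
  rw [velocity, div_le_div_iff₀ (by norm_num) (sqrt_one_add_sq_pos 1)]
  have : Real.sqrt (1 + 1 ^ 2) ≤ 2 := by
    rw [Real.sqrt_le_left (by norm_num)]; norm_num
  linarith

lemma lipschitzWith_velocity : LipschitzWith 1 velocity := by
  have hd : ∀ x, HasDerivAt velocity ((Real.sqrt (1 + x ^ 2))⁻¹ ^ 3) x := by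
    intro x
    have hpos : 0 < 1 + x ^ 2 := by positivity
    have hr := sqrt_one_add_sq_pos x
    have h1 : HasDerivAt (fun x : ℝ => 1 + x ^ 2) (2 * x) x := by
      simpa using (hasDerivAt_pow 2 x).const_add 1
    have h2 := (hasDerivAt_id x).div (h1.sqrt hpos.ne') hr.ne'
    refine h2.congr_deriv ?_
    have hsq : Real.sqrt (1 + x ^ 2) ^ 2 = 1 + x ^ 2 := Real.sq_sqrt hpos.le
    simp only [id]
    field_simp
    rw [hsq]
    ring
  refine lipschitzWith_of_nnnorm_deriv_le (fun x => (hd x).differentiableAt) fun x => ?_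
  rw [(hd x).deriv, ← NNReal.coe_le_coe, coe_nnnorm, Real.norm_eq_abs,
    abs_of_nonneg (by positivity)]
  have : 1 ≤ Real.sqrt (1 + x ^ 2) := Real.one_le_sqrt.mpr (by nlinarith [sq_nonneg x])
  exact pow_le_one₀ (by positivity) (inv_le_one_of_one_le₀ this)

lemma convexOn_kinetic : ConvexOn ℝ (Icc (-1) 1) kinetic := by
  refine ⟨convex_Icc _ _, ?_⟩
  intro x hx y hy α β hα hβ hαβ
  simp only [smul_eq_mul, kinetic]
  have hx2 : 0 ≤ 1 - x ^ 2 := by nlinarith [hx.1, hx.2]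
  have hy2 : 0 ≤ 1 - y ^ 2 := by nlinarith [hy.1, hy.2]
  have key : α * Real.sqrt (1 - x ^ 2) + β * Real.sqrt (1 - y ^ 2)
      ≤ Real.sqrt (1 - (α * x + β * y) ^ 2) := by
    apply Real.le_sqrt_of_sq_le
    have e1 := Real.sq_sqrt hx2
    have e2 := Real.sq_sqrt hy2
    set s := Real.sqrt (1 - x ^ 2)
    set r := Real.sqrt (1 - y ^ 2)
    have hcs : s * r + x * y ≤ 1 := by nlinarith [sq_nonneg (s - r), sq_nonneg (x - y)]
    have h1 : 1 = (α + β) ^ 2 := by rw [hαβ]; ring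
    have hm := mul_le_mul_of_nonneg_left hcs (mul_nonneg hα hβ)
    have e3 : α ^ 2 * s ^ 2 = α ^ 2 * (1 - x ^ 2) := by rw [e1]
    have e4 : β ^ 2 * r ^ 2 = β ^ 2 * (1 - y ^ 2) := by rw [e2]
    nlinarith
  linarith

lemma DoubleWell.nonneg {W : ℝ → ℝ} (hW : DoubleWell W) (s : ℝ) : 0 ≤ W s := by
  by_cases h1 : s = -1
  · rw [h1, hW.2.1]
  by_cases h2 : s = 1
  · rw [h2, hW.2.2.1]
  exact (hW.2.2.2 s h1 h2).le

lemma actionDensity_congr {a W u v : ℝ → ℝ} {t : ℝ} (h : u =ᶠ[𝓝 t] v) :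
    actionDensity a W u t = actionDensity a W v t := by
  rw [actionDensity, actionDensity, h.deriv_eq, h.eq_of_nhds]

lemma actionDensity_le {a W u : ℝ → ℝ} {t A M : ℝ} (ha : a t ≤ A) (hA : 0 ≤ A)
    (hW0 : 0 ≤ W (u t)) (hWM : W (u t) ≤ M) :
    actionDensity a W u t ≤ ENNReal.ofReal (1 + A * M) :=
  ENNReal.ofReal_le_ofReal
    (add_le_add (kinetic_le_one _) (mul_le_mul ha hWM hW0 hA))

lemma abs_deriv_le_one {u : ℝ → ℝ} (hu : LipschitzWith 1 u) (t : ℝ) : |deriv u t| ≤ 1 := by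
  simpa using norm_deriv_le_of_lipschitz hu (x₀ := t)

lemma lipschitzWith_one_of_le {u : ℝ → ℝ} (h : ∀ s t, s ≤ t → |u t - u s| ≤ t - s) :
    LipschitzWith 1 u := by
  refine LipschitzWith.of_dist_le_mul fun x y => ?_
  simp only [NNReal.coe_one, one_mul, Real.dist_eq]
  rcases le_total x y with hxy | hxy
  · rw [abs_sub_comm, abs_sub_comm x, abs_of_nonneg (sub_nonneg.mpr hxy)]
    exact h x y hxy
  · rw [abs_of_nonneg (sub_nonneg.mpr hxy)]
    exact h y x hxy

lemma LipschitzWith.abs_sub_le_of_one {u : ℝ → ℝ} (hu : LipschitzWith 1 u) (s t : ℝ) :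
    |u t - u s| ≤ |t - s| := by
  simpa [Real.dist_eq] using hu.dist_le_mul t s

/-- The function equal to `f` up to `c` and to `g` afterwards. -/
def glueAt (c : ℝ) (f g : ℝ → ℝ) (t : ℝ) : ℝ := if t ≤ c then f t else g t

lemma glueAt_of_le {c t : ℝ} (f g : ℝ → ℝ) (h : t ≤ c) : glueAt c f g t = f t := if_pos h

lemma glueAt_of_lt {c t : ℝ} (f g : ℝ → ℝ) (h : c < t) : glueAt c f g t = g t :=
  if_neg h.not_ge

lemma glueAt_eventuallyEq_left {c t : ℝ} (f g : ℝ → ℝ) (h : t < c) :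
    glueAt c f g =ᶠ[𝓝 t] f := by
  filter_upwards [Iio_mem_nhds h] with x hx using glueAt_of_le f g (le_of_lt hx)

lemma glueAt_eventuallyEq_right {c t : ℝ} (f g : ℝ → ℝ) (h : c < t) :
    glueAt c f g =ᶠ[𝓝 t] g := by
  filter_upwards [Ioi_mem_nhds h] with x hx using glueAt_of_lt f g hx

lemma lipschitzWith_glueAt {c : ℝ} {f g : ℝ → ℝ} (hf : LipschitzWith 1 f)
    (hg : LipschitzWith 1 g) (h : f c = g c) : LipschitzWith 1 (glueAt c f g) := by
  refine lipschitzWith_one_of_le fun s t hst => ?_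
  have key : ∀ {u : ℝ → ℝ}, LipschitzWith 1 u → ∀ {s t}, s ≤ t → |u t - u s| ≤ t - s := by
    intro u hu s t hst
    simpa [abs_of_nonneg (sub_nonneg.mpr hst)] using hu.abs_sub_le_of_one s t
  rcases le_or_gt t c with ht | ht
  · rw [glueAt_of_le f g ht, glueAt_of_le f g (hst.trans ht)]
    exact key hf hst
  · rcases le_or_gt s c with hs | hs
    · rw [glueAt_of_lt f g ht, glueAt_of_le f g hs]
      have h1 := abs_le.mp (key hg ht.le)
      have h2 := abs_le.mp (key hf hs)
      rw [abs_le]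
      constructor <;> linarith [h1.1, h1.2, h2.1, h2.2]
    · rw [glueAt_of_lt f g ht, glueAt_of_lt f g hs]
      exact key hg hst

lemma setLIntegral_Iic_glueAt (a W f g : ℝ → ℝ) (c : ℝ) :
    ∫⁻ t in Iic c, actionDensity a W (glueAt c f g) t = ∫⁻ t in Iic c, actionDensity a W f t := by
  rw [setLIntegral_congr Iio_ae_eq_Iic.symm, setLIntegral_congr (Iio_ae_eq_Iic (a := c)).symm]
  exact setLIntegral_congr_fun measurableSet_Iio fun t ht =>
    actionDensity_congr (glueAt_eventuallyEq_left f g ht)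

lemma setLIntegral_Ioi_glueAt (a W f g : ℝ → ℝ) (c : ℝ) {s : Set ℝ} (hs : MeasurableSet s)
    (hsc : s ⊆ Ioi c) :
    ∫⁻ t in s, actionDensity a W (glueAt c f g) t = ∫⁻ t in s, actionDensity a W g t :=
  setLIntegral_congr_fun hs fun _ ht =>
    actionDensity_congr (glueAt_eventuallyEq_right f g (hsc ht))

lemma LaE_eq_Iic_add_Ioi (a W u : ℝ → ℝ) (c : ℝ) :
    LaE a W u = (∫⁻ t in Iic c, actionDensity a W u t) + ∫⁻ t in Ioi c, actionDensity a W u t := by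
  rw [LaE_eq, ← lintegral_add_compl _ (measurableSet_Iic (a := c)), compl_Iic]

lemma LaE_glueAt (a W f g : ℝ → ℝ) (c : ℝ) :
    LaE a W (glueAt c f g)
      = (∫⁻ t in Iic c, actionDensity a W f t) + ∫⁻ t in Ioi c, actionDensity a W g t := by
  rw [LaE_eq_Iic_add_Ioi _ _ _ c, setLIntegral_Iic_glueAt,
    setLIntegral_Ioi_glueAt a W f g c measurableSet_Ioi subset_rfl]

lemma setLIntegral_Iic_eq_add_Ioc (f : ℝ → ℝ≥0∞) {α β : ℝ} (h : α ≤ β) :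
    ∫⁻ t in Iic β, f t = (∫⁻ t in Iic α, f t) + ∫⁻ t in Ioc α β, f t := by
  rw [← Iic_union_Ioc_eq_Iic h, lintegral_union measurableSet_Ioc]
  exact Set.disjoint_left.mpr fun x hx hx' => not_lt.mpr hx hx'.1

lemma memX1_glueAt {c : ℝ} {f g : ℝ → ℝ} (hf : LipschitzWith 1 f) (hf' : Tendsto f atBot (𝓝 (-1)))
    (hg : LipschitzWith 1 g) (hg' : Tendsto g atTop (𝓝 1)) (h : f c = g c) :
    memX1 (glueAt c f g) := by
  refine ⟨lipschitzWith_glueAt hf hg h, hg'.congr' ?_, hf'.congr' ?_⟩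
  · filter_upwards [Ioi_mem_atTop c] with t ht using (glueAt_of_lt f g ht).symm
  · filter_upwards [Iic_mem_atBot c] with t ht using (glueAt_of_le f g ht).symm

/-- A minimizer of finite action also minimizes locally, with fixed boundary values. -/
lemma setLIntegral_Ioc_le_of_isMinimizer {a W u z : ℝ → ℝ} {α β : ℝ} (hu : memX1 u)
    (hmin : ∀ v, memX1 v → LaE a W u ≤ LaE a W v) (hfin : LaE a W u ≠ ∞)
    (hz : LipschitzWith 1 z) (hαβ : α ≤ β) (hα : z α = u α) (hβ : z β = u β) :
    ∫⁻ t in Ioc α β, actionDensity a W u t ≤ ∫⁻ t in Ioc α β, actionDensity a W z t := by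
  rcases hαβ.eq_or_lt with rfl | hlt
  · simp
  have hv1 : LipschitzWith 1 (glueAt α u z) := lipschitzWith_glueAt hu.1 hz hα.symm
  have hv2 : glueAt α u z β = u β := by rw [glueAt_of_lt _ _ hlt, hβ]
  have hv3 : Tendsto (glueAt α u z) atBot (𝓝 (-1)) := by
    refine hu.2.2.congr' ?_
    filter_upwards [Iic_mem_atBot α] with t ht using (glueAt_of_le u z ht).symm
  have h := hmin _ (memX1_glueAt hv1 hv3 hu.1 hu.2.1 hv2)
  have hsub : Ioc α β ⊆ Ioi α := fun x hx => hx.1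
  have e1 := LaE_eq_Iic_add_Ioi a W u β
  rw [setLIntegral_Iic_eq_add_Ioc _ hαβ] at e1
  rw [LaE_glueAt, setLIntegral_Iic_eq_add_Ioc _ hαβ, setLIntegral_Iic_glueAt,
    setLIntegral_Ioi_glueAt a W u z α measurableSet_Ioc hsub, e1] at h
  rw [e1] at hfin
  simp only [ne_eq, ENNReal.add_eq_top, not_or] at hfin
  rw [ENNReal.add_le_add_iff_right hfin.2] at h
  rwa [ENNReal.add_le_add_iff_left hfin.1.1] at h

lemma LaE_comp_add_mul_period {a : ℝ → ℝ} {T : ℝ} (hper : Function.Periodic a T) (W u : ℝ → ℝ)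
    (k : ℤ) : LaE a W (fun t => u (t + k * T)) = LaE a W u := by
  rw [LaE_eq, LaE_eq, ← lintegral_add_right_eq_self (actionDensity a W u) (k * T)]
  congr 1
  ext t
  rw [actionDensity, actionDensity, deriv_comp_add_const, hper.int_mul k t]

lemma memX1_comp_add_const {u : ℝ → ℝ} (hu : memX1 u) (c : ℝ) : memX1 (fun t => u (t + c)) := by
  refine ⟨?_, hu.2.1.comp (tendsto_atTop_add_const_right _ c tendsto_id),
    hu.2.2.comp (tendsto_atBot_add_const_right _ c tendsto_id)⟩
  refine LipschitzWith.of_dist_le_mul fun x y => ?_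
  simpa using hu.1.dist_le_mul (x + c) (y + c)

/-- Truncation of a function to values in `[-1, 1]`. -/
def clip (u : ℝ → ℝ) (t : ℝ) : ℝ := max (-1) (min 1 (u t))

lemma clip_mem_Icc (u : ℝ → ℝ) (t : ℝ) : clip u t ∈ Icc (-1 : ℝ) 1 :=
  ⟨le_max_left _ _, max_le (by norm_num) (min_le_left _ _)⟩

lemma memX1_clip {u : ℝ → ℝ} (hu : memX1 u) : memX1 (clip u) := by
  refine ⟨(hu.1.const_min 1).const_max (-1), ?_, ?_⟩ <;> unfold clip
  · have := (tendsto_const_nhds (x := (-1 : ℝ))).max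
      ((tendsto_const_nhds (x := (1 : ℝ))).min hu.2.1)
    simpa using this
  · have := (tendsto_const_nhds (x := (-1 : ℝ))).max
      ((tendsto_const_nhds (x := (1 : ℝ))).min hu.2.2)
    simpa using this

lemma actionDensity_clip_le {W u : ℝ → ℝ} (a : ℝ → ℝ) (hW : DoubleWell W) (hu : Continuous u)
    (t : ℝ) : actionDensity a W (clip u) t ≤ actionDensity a W u t := by
  rcases le_or_gt 1 (u t) with h1 | h1
  · have hval : clip u t = 1 := by simp [clip, min_eq_left h1]
    have hmax : IsLocalMax (clip u) t :=
      Eventually.of_forall fun s => hval ▸ (clip_mem_Icc u s).2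
    simp [actionDensity, hmax.deriv_eq_zero, hval, hW.2.2.1]
  rcases le_or_gt (u t) (-1) with h2 | h2
  · have hval : clip u t = -1 := by simp [clip, min_eq_right h1.le, h2]
    have hmin : IsLocalMin (clip u) t :=
      Eventually.of_forall fun s => hval ▸ (clip_mem_Icc u s).1
    simp [actionDensity, hmin.deriv_eq_zero, hval, hW.2.1]
  · refine (actionDensity_congr ?_).le
    filter_upwards [hu.continuousAt.eventually (Ioo_mem_nhds h2 h1)] with s hs
    simp [clip, min_eq_right hs.2.le, max_eq_right hs.1.le]

lemma LaE_clip_le {W u : ℝ → ℝ} (a : ℝ → ℝ) (hW : DoubleWell W) (hu : Continuous u) :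
    LaE a W (clip u) ≤ LaE a W u :=
  lintegral_mono fun t => actionDensity_clip_le a hW hu t

lemma exists_forall_le_of_continuous {W : ℝ → ℝ} (hW : Continuous W) (R : ℝ) :
    ∃ M : ℝ, 0 ≤ M ∧ ∀ s ∈ Icc (-R) R, |W s| ≤ M := by
  obtain ⟨M, hM⟩ := isCompact_Icc.exists_bound_of_continuousOn (hW.continuousOn (s := Icc (-R) R))
  exact ⟨max M 0, le_max_right _ _, fun s hs => (hM s hs).trans (le_max_left _ _)⟩

/-- The ramp from `y` at `c` up to `1` with unit slope. -/
def rampUp (c y : ℝ) (t : ℝ) : ℝ := min 1 (y + (t - c))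

lemma lipschitzWith_rampUp (c y : ℝ) : LipschitzWith 1 (rampUp c y) := by
  refine LipschitzWith.const_min ?_ 1
  refine LipschitzWith.of_dist_le_mul fun s t => ?_
  simp [Real.dist_eq]

lemma tendsto_rampUp (c y : ℝ) : Tendsto (rampUp c y) atTop (𝓝 1) := by
  refine tendsto_const_nhds.congr' ?_
  filter_upwards [Ici_mem_atTop (c + (1 - y))] with t ht
  rw [rampUp, min_eq_left]
  linarith [mem_Ici.mp ht]

lemma setLIntegral_rampUp_le {a W : ℝ → ℝ} {A M c y : ℝ} (hA : 0 ≤ A) (ha : ∀ t, a t ≤ A)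
    (hW : DoubleWell W) (hM : ∀ s ∈ Icc (-1 : ℝ) 1, W s ≤ M) (hy : y ∈ Icc (-1 : ℝ) 1) :
    ∫⁻ t in Ioi c, actionDensity a W (rampUp c y) t
      ≤ ENNReal.ofReal (1 + A * M) * ENNReal.ofReal (1 - y) := by
  have hle : c ≤ c + (1 - y) := by linarith [hy.2]
  rw [← Ioc_union_Ioi_eq_Ioi hle, lintegral_union measurableSet_Ioi
    (Set.disjoint_left.mpr fun x hx hx' => not_lt.mpr hx.2 hx')]
  have h2 : ∫⁻ t in Ioi (c + (1 - y)), actionDensity a W (rampUp c y) t = 0 := by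
    rw [setLIntegral_congr_fun (g := fun _ => 0) measurableSet_Ioi, lintegral_zero]
    intro t ht
    have : rampUp c y =ᶠ[𝓝 t] fun _ => 1 := by
      filter_upwards [Ioi_mem_nhds ht] with s hs
      rw [rampUp, min_eq_left]
      linarith [mem_Ioi.mp hs]
    beta_reduce
    rw [actionDensity_congr this]
    simp [actionDensity, hW.2.2.1]
  rw [h2, add_zero]
  refine (setLIntegral_mono measurable_const (g := fun _ => ENNReal.ofReal (1 + A * M))
    fun t ht => ?_).trans ?_
  · refine actionDensity_le (ha t) hA (hW.nonneg _) (hM _ ⟨?_, min_le_left _ _⟩)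
    exact le_min (by norm_num) (by linarith [hy.1, ht.1])
  · rw [setLIntegral_const, Real.volume_Ioc, add_sub_cancel_left]

/-- There is a competitor of finite action. -/
lemma exists_memX1_LaE_ne_top {a W : ℝ → ℝ} {A : ℝ} (hA : 0 ≤ A) (ha : ∀ t, a t ≤ A)
    (hW : DoubleWell W) : ∃ u, memX1 u ∧ LaE a W u ≠ ∞ := by
  obtain ⟨M, -, hM⟩ := exists_forall_le_of_continuous hW.1.continuous 1
  have h1 : Tendsto (fun _ : ℝ => (-1 : ℝ)) atBot (𝓝 (-1)) := tendsto_const_nhds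
  refine ⟨glueAt 0 (fun _ => -1) (rampUp 0 (-1)), memX1_glueAt (LipschitzWith.const' _) h1
    (lipschitzWith_rampUp _ _) (tendsto_rampUp _ _) (by simp [rampUp]), ?_⟩
  rw [LaE_glueAt]
  have h2 : ∫⁻ t in Iic (0 : ℝ), actionDensity a W (fun _ => -1) t = 0 := by
    simp [actionDensity, hW.2.1]
  rw [h2, zero_add]
  exact ne_top_of_le_ne_top (ENNReal.mul_ne_top ENNReal.ofReal_ne_top ENNReal.ofReal_ne_top)
    (setLIntegral_rampUp_le hA ha hW (fun s hs => (le_abs_self _).trans (hM s hs))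
      ⟨le_rfl, by norm_num⟩)

lemma absolutelyContinuousOnInterval_of_lipschitzWith {u : ℝ → ℝ} {K : NNReal}
    (hu : LipschitzWith K u) (s t : ℝ) : AbsolutelyContinuousOnInterval u s t :=
  hu.lipschitzOnWith.absolutelyContinuousOnInterval

lemma integral_deriv_of_lipschitzWith {u : ℝ → ℝ} {K : NNReal} (hu : LipschitzWith K u)
    (s t : ℝ) : ∫ x in s..t, deriv u x = u t - u s :=
  (absolutelyContinuousOnInterval_of_lipschitzWith hu s t).integral_deriv_eq_sub

/-- Jensen's inequality for the difference quotient of a Lipschitz function. -/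
lemma kinetic_slope_le {v : ℝ → ℝ} (hv : LipschitzWith 1 v) {h : ℝ} (hh : 0 < h) (t : ℝ) :
    ENNReal.ofReal (kinetic ((v (t + h) - v t) / h))
      ≤ ∫⁻ s in Ioc (0 : ℝ) 1, ENNReal.ofReal (kinetic (deriv v (t + h * s))) := by
  have hmeas : Measurable fun s : ℝ => deriv v (t + h * s) :=
    (measurable_deriv v).comp (by fun_prop)
  have hkm : Measurable fun s : ℝ => kinetic (deriv v (t + h * s)) :=
    continuous_kinetic.measurable.comp hmeas
  have : IsProbabilityMeasure (volume.restrict (Ioc (0 : ℝ) 1)) := ⟨by simp⟩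
  have hint : Integrable (fun s : ℝ => deriv v (t + h * s)) (volume.restrict (Ioc (0 : ℝ) 1)) :=
    Integrable.of_bound hmeas.aestronglyMeasurable 1
      (Eventually.of_forall fun s => abs_deriv_le_one hv _)
  have hkint : Integrable (fun s : ℝ => kinetic (deriv v (t + h * s)))
      (volume.restrict (Ioc (0 : ℝ) 1)) :=
    Integrable.of_bound hkm.aestronglyMeasurable 1 (Eventually.of_forall fun s => by
      rw [Real.norm_eq_abs, abs_of_nonneg (kinetic_nonneg _)]
      exact kinetic_le_one _)
  have hJ := convexOn_kinetic.map_integral_le (μ := volume.restrict (Ioc (0 : ℝ) 1))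
    continuous_kinetic.continuousOn isClosed_Icc
    (Eventually.of_forall fun s => abs_le.mp (abs_deriv_le_one hv (t + h * s))) hint hkint
  have havg : ∫ s in Ioc (0 : ℝ) 1, deriv v (t + h * s) = (v (t + h) - v t) / h := by
    rw [← intervalIntegral.integral_of_le zero_le_one,
      intervalIntegral.integral_comp_add_mul (fun x => deriv v x) hh.ne',
      integral_deriv_of_lipschitzWith hv]
    simp [div_eq_inv_mul]
  rw [havg] at hJ
  refine (ENNReal.ofReal_le_ofReal hJ).trans ?_
  rw [ofReal_integral_eq_lintegral_ofReal hkint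
    (Eventually.of_forall fun s => kinetic_nonneg _)]

lemma lintegral_kinetic_slope_le {v : ℝ → ℝ} (hv : LipschitzWith 1 v) {h : ℝ} (hh : 0 < h) :
    ∫⁻ t, ENNReal.ofReal (kinetic ((v (t + h) - v t) / h))
      ≤ ∫⁻ t, ENNReal.ofReal (kinetic (deriv v t)) := by
  refine (lintegral_mono fun t => kinetic_slope_le hv hh t).trans ?_
  have hm : Measurable fun p : ℝ × ℝ => ENNReal.ofReal (kinetic (deriv v (p.1 + h * p.2))) :=
    (continuous_kinetic.measurable.comp
      ((measurable_deriv v).comp (by fun_prop))).ennreal_ofReal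
  rw [lintegral_lintegral_swap hm.aemeasurable]
  have : ∀ s : ℝ, ∫⁻ t, ENNReal.ofReal (kinetic (deriv v (t + h * s)))
      = ∫⁻ t, ENNReal.ofReal (kinetic (deriv v t)) := fun s =>
    lintegral_add_right_eq_self (fun t => ENNReal.ofReal (kinetic (deriv v t))) (h * s)
  simp [this]

/-- The action with the derivative replaced by a difference quotient of step `h`. -/
def slopeAction (a W : ℝ → ℝ) (h : ℝ) (v : ℝ → ℝ) : ℝ≥0∞ :=
  ∫⁻ t, (ENNReal.ofReal (kinetic ((v (t + h) - v t) / h)) + ENNReal.ofReal (a t * W (v t)))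

lemma actionDensity_eq_add {a W : ℝ → ℝ} (ha : ∀ t, 0 ≤ a t) (hW : ∀ s, 0 ≤ W s) (u : ℝ → ℝ)
    (t : ℝ) : actionDensity a W u t
      = ENNReal.ofReal (kinetic (deriv u t)) + ENNReal.ofReal (a t * W (u t)) :=
  ENNReal.ofReal_add (kinetic_nonneg _) (mul_nonneg (ha t) (hW _))

lemma measurable_kinetic_slope {v : ℝ → ℝ} (hv : Continuous v) (h : ℝ) :
    Measurable fun t => ENNReal.ofReal (kinetic ((v (t + h) - v t) / h)) := by
  have := continuous_kinetic
  exact Measurable.ennreal_ofReal (Continuous.measurable (by fun_prop))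

lemma slopeAction_le_LaE {a W v : ℝ → ℝ} (ha : ∀ t, 0 ≤ a t) (hW : ∀ s, 0 ≤ W s)
    (hv : LipschitzWith 1 v) {h : ℝ} (hh : 0 < h) : slopeAction a W h v ≤ LaE a W v := by
  rw [slopeAction, LaE_eq, lintegral_add_left (measurable_kinetic_slope hv.continuous h)]
  simp_rw [actionDensity_eq_add ha hW]
  have hm : Measurable fun t => ENNReal.ofReal (kinetic (deriv v t)) :=
    (continuous_kinetic.measurable.comp (measurable_deriv v)).ennreal_ofReal
  rw [lintegral_add_left hm]
  exact add_le_add (lintegral_kinetic_slope_le hv hh) le_rfl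

/-- The action is sequentially lower semicontinuous under pointwise convergence. -/
lemma LaE_le_liminf {a W u : ℝ → ℝ} {v : ℕ → ℝ → ℝ} (hma : Measurable a) (ha : ∀ t, 0 ≤ a t)
    (hWc : Continuous W) (hW : ∀ s, 0 ≤ W s) (hv : ∀ n, LipschitzWith 1 (v n))
    (hu : LipschitzWith 1 u) (hlim : ∀ t, Tendsto (fun n => v n t) atTop (𝓝 (u t))) :
    LaE a W u ≤ liminf (fun n => LaE a W (v n)) atTop := by
  have hpot : ∀ {w : ℝ → ℝ}, Continuous w →
      Measurable fun t => ENNReal.ofReal (a t * W (w t)) := fun hw =>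
    (hma.mul (hWc.comp hw).measurable).ennreal_ofReal
  have step1 : ∀ h, 0 < h → slopeAction a W h u ≤ liminf (fun n => LaE a W (v n)) atTop := by
    intro h hh
    refine le_trans ?_ (liminf_le_liminf (Eventually.of_forall fun n =>
      slopeAction_le_LaE ha hW (hv n) hh))
    refine le_trans (lintegral_mono fun t => ?_) (lintegral_liminf_le fun n =>
      (measurable_kinetic_slope (hv n).continuous h).add (hpot (hv n).continuous))
    refine (Tendsto.liminf_eq (Tendsto.add ?_ ?_)).ge
    · exact (ENNReal.continuous_ofReal.comp continuous_kinetic).tendsto _ |>.comp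
        (((hlim (t + h)).sub (hlim t)).div_const h)
    · exact ENNReal.tendsto_ofReal (((hWc.tendsto _).comp (hlim t)).const_mul (a t))
  have hstep : Tendsto (fun k : ℕ => 1 / ((k : ℝ) + 1)) atTop (𝓝[≠] 0) :=
    tendsto_nhdsWithin_iff.mpr ⟨tendsto_one_div_add_atTop_nhds_zero_nat,
      Eventually.of_forall fun k => (Nat.one_div_pos_of_nat (α := ℝ)).ne'⟩
  have step2 : LaE a W u ≤ liminf (fun k : ℕ => slopeAction a W (1 / ((k : ℝ) + 1)) u) atTop := by
    rw [LaE_eq]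
    refine le_trans (lintegral_mono_ae ?_) (lintegral_liminf_le fun k =>
      (measurable_kinetic_slope hu.continuous _).add (hpot hu.continuous))
    filter_upwards [hu.ae_differentiableAt_real] with t ht
    rw [actionDensity_eq_add ha hW]
    refine (Tendsto.liminf_eq (Tendsto.add ?_ tendsto_const_nhds)).ge
    have h1 := (hasDerivAt_iff_tendsto_slope_zero.mp ht.hasDerivAt).comp hstep
    refine (ENNReal.continuous_ofReal.comp continuous_kinetic).tendsto _ |>.comp ?_
    simpa [Function.comp_def, div_eq_inv_mul] using h1
  refine step2.trans ?_
  refine (liminf_le_liminf (Eventually.of_forall fun k : ℕ =>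
    step1 _ Nat.one_div_pos_of_nat)).trans ?_
  simp

lemma lipschitzWith_of_tendsto {v : ℕ → ℝ → ℝ} {u : ℝ → ℝ} (hv : ∀ n, LipschitzWith 1 (v n))
    (hlim : ∀ t, Tendsto (fun n => v n t) atTop (𝓝 (u t))) : LipschitzWith 1 u :=
  LipschitzWith.of_dist_le_mul fun x y =>
    le_of_tendsto ((hlim x).dist (hlim y)) (Eventually.of_forall fun n => (hv n).dist_le_mul x y)

/-- Compactness of bounded `1`-Lipschitz functions for pointwise convergence. -/
lemma exists_subseq_tendsto_of_lipschitzWith {v : ℕ → ℝ → ℝ} (hv : ∀ n, LipschitzWith 1 (v n))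
    (hb : ∀ n t, v n t ∈ Icc (-1 : ℝ) 1) :
    ∃ (u : ℝ → ℝ) (φ : ℕ → ℕ), StrictMono φ ∧
      ∀ t, Tendsto (fun n => v (φ n) t) atTop (𝓝 (u t)) := by
  have hK : IsCompact (Set.pi univ fun _ : ℚ => Icc (-1 : ℝ) 1) :=
    isCompact_univ_pi fun _ => isCompact_Icc
  obtain ⟨f, -, φ, hφ, hf⟩ := hK.tendsto_subseq (x := fun n (q : ℚ) => v n q)
    fun n q _ => hb n q
  rw [tendsto_pi_nhds] at hf
  have hcauchy : ∀ t, CauchySeq fun n => v (φ n) t := by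
    intro t
    rw [Metric.cauchySeq_iff']
    intro ε hε
    obtain ⟨q, hq1, hq2⟩ := exists_rat_btwn (show t < t + ε / 4 by linarith)
    obtain ⟨N, hN⟩ := Metric.cauchySeq_iff'.mp (hf q).cauchySeq (ε / 4) (by linarith)
    refine ⟨N, fun n hn => ?_⟩
    have h1 := abs_le.mp ((hv (φ n)).abs_sub_le_of_one q t)
    have h2 := abs_le.mp ((hv (φ N)).abs_sub_le_of_one q t)
    have h3 := hN n hn
    simp only [Function.comp_apply, Real.dist_eq] at h3
    have h3 := abs_lt.mp h3
    have h4 : |t - q| ≤ ε / 4 := by rw [abs_le]; constructor <;> linarith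
    rw [Real.dist_eq, abs_lt]
    constructor <;> linarith [h1.1, h1.2, h2.1, h2.2, h3.1, h3.2]
  choose u hu using fun t => cauchySeq_tendsto_of_complete (hcauchy t)
  exact ⟨u, φ, hφ, hu⟩

/-- A function staying away from the wells near `t` spends a fixed amount of action there. -/
lemma exists_pos_le_setLIntegral {a W : ℝ → ℝ} {a₁ r : ℝ} (ha₁ : 0 < a₁) (ha : ∀ t, a₁ ≤ a t)
    (hW : DoubleWell W) (hr : 0 < r) :
    ∃ c : ℝ, 0 < c ∧ ∀ u : ℝ → ℝ, LipschitzWith 1 u → ∀ t, |u t| ≤ 1 - 2 * r →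
      ENNReal.ofReal c ≤ ∫⁻ s in Icc (t - r) (t + r), actionDensity a W u s := by
  rcases lt_or_ge 1 r with hr1 | hr1
  · exact ⟨1, one_pos, fun u _ t ht => by linarith [abs_nonneg (u t)]⟩
  obtain ⟨x, hx, hmin⟩ := (isCompact_Icc (a := -(1 - r)) (b := 1 - r)).exists_isMinOn
    ⟨0, by constructor <;> linarith⟩ hW.1.continuous.continuousOn
  have hWx : 0 < W x := hW.2.2.2 x (by linarith [hx.1]) (by linarith [hx.2])
  refine ⟨a₁ * W x * (2 * r), by positivity, fun u hu t ht => ?_⟩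
  have hle : ∀ s ∈ Icc (t - r) (t + r), ENNReal.ofReal (a₁ * W x) ≤ actionDensity a W u s := by
    intro s hs
    have h1 := hu.abs_sub_le_of_one t s
    have h2 : |s - t| ≤ r := by rw [abs_le]; constructor <;> linarith [hs.1, hs.2]
    have h3 : u s ∈ Icc (-(1 - r)) (1 - r) := by
      have h1 := abs_le.mp (h1.trans h2)
      have ht := abs_le.mp ht
      constructor <;> linarith [h1.1, h1.2, ht.1, ht.2]
    refine ENNReal.ofReal_le_ofReal ?_
    have h4 : a₁ * W x ≤ a s * W (u s) :=
      mul_le_mul (ha s) (hmin h3) hWx.le (ha₁.le.trans (ha s))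
    have := kinetic_nonneg (deriv u s)
    unfold kinetic at this
    linarith
  refine le_trans (le_of_eq ?_) (setLIntegral_mono' measurableSet_Icc hle)
  rw [setLIntegral_const, Real.volume_Icc, ← ENNReal.ofReal_mul (by positivity)]
  congr 1
  ring

lemma exists_setLIntegral_compl_Icc_lt {f : ℝ → ℝ≥0∞} (hf : ∫⁻ t, f t ≠ ∞) {c : ℝ≥0∞}
    (hc : 0 < c) : ∃ R : ℝ, ∫⁻ t in (Icc (-R) R)ᶜ, f t < c := by
  have hfin : IsFiniteMeasure (volume.withDensity f) := isFiniteMeasure_withDensity hf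
  have hm : ∀ n : ℕ, MeasurableSet (Icc (-(n : ℝ)) n)ᶜ := fun n => measurableSet_Icc.compl
  have hanti : Antitone fun n : ℕ => (Icc (-(n : ℝ)) n)ᶜ := fun m n hmn =>
    compl_subset_compl.mpr (Icc_subset_Icc (by gcongr) (by gcongr))
  have h := tendsto_measure_iInter_atTop (μ := volume.withDensity f)
    (fun n => (hm n).nullMeasurableSet) hanti ⟨0, measure_ne_top _ _⟩
  have hempty : ⋂ n : ℕ, (Icc (-(n : ℝ)) n)ᶜ = ∅ := by
    rw [← compl_iUnion, compl_empty_iff, eq_univ_iff_forall]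
    intro x
    obtain ⟨n, hn⟩ := exists_nat_ge |x|
    exact mem_iUnion.mpr ⟨n, abs_le.mp hn⟩
  rw [hempty, measure_empty] at h
  obtain ⟨n, hn⟩ := (h.eventually (gt_mem_nhds hc)).exists
  refine ⟨n, ?_⟩
  simpa [withDensity_apply f (hm n)] using hn

/-- A function of finite action eventually stays close to the wells. -/
lemma exists_forall_lt_abs {a W u : ℝ → ℝ} {a₁ : ℝ} (ha₁ : 0 < a₁) (ha : ∀ t, a₁ ≤ a t)
    (hW : DoubleWell W) (hu : LipschitzWith 1 u) (hfin : LaE a W u ≠ ∞) {ε : ℝ} (hε : 0 < ε) :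
    ∃ R : ℝ, ∀ t, R < |t| → 1 - ε < |u t| := by
  obtain ⟨c, hc, hlow⟩ := exists_pos_le_setLIntegral ha₁ ha hW (half_pos hε)
  obtain ⟨R, hR⟩ := exists_setLIntegral_compl_Icc_lt hfin (ENNReal.ofReal_pos.mpr hc)
  refine ⟨R + ε / 2, fun t ht => ?_⟩
  by_contra! hut
  refine (hlow u hu t (by linarith)).not_gt (lt_of_le_of_lt (lintegral_mono_set ?_) hR)
  intro s hs hsR
  have h1 : |t| ≤ |s| + ε / 2 := by
    have h2 : |t - s| ≤ ε / 2 := by rw [abs_le]; constructor <;> linarith [hs.1, hs.2]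
    linarith [abs_sub_abs_le_abs_sub t s]
  linarith [abs_le.mpr hsR]

/-- Truncating and translating by a multiple of the period, one may assume that a competitor takes
values in `[-1, 1]` and has its last zero in `[0, T]`. -/
lemma exists_normalized_competitor {a W v : ℝ → ℝ} {T : ℝ} (hT : 0 < T)
    (hper : Function.Periodic a T) (hW : DoubleWell W) (hv : memX1 v) :
    ∃ w, memX1 w ∧ (∀ t, w t ∈ Icc (-1 : ℝ) 1) ∧ LaE a W w ≤ LaE a W v ∧
      ∃ s ∈ Icc 0 T, w s = 0 ∧ ∀ t, s < t → 0 < w t := by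
  have hc := memX1_clip hv
  have hcont := hc.1.continuous
  set S := {t | clip v t ≤ 0} with hS
  have hclosed : IsClosed S := isClosed_le hcont continuous_const
  have hne : S.Nonempty :=
    ((hc.2.2.eventually (gt_mem_nhds (show (-1 : ℝ) < 0 by norm_num))).exists).imp fun t ht => ht.le
  have hbdd : BddAbove S := by
    obtain ⟨B, hB⟩ := eventually_atTop.mp
      (hc.2.1.eventually (lt_mem_nhds (show (0 : ℝ) < 1 by norm_num)))
    exact ⟨B, fun t ht => le_of_not_gt fun hlt => not_lt.mpr ht (hB t hlt.le)⟩
  set s := sSup S with hs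
  have hsS : clip v s ≤ 0 := hclosed.csSup_mem hne hbdd
  have hpos : ∀ t, s < t → 0 < clip v t := fun t ht =>
    lt_of_not_ge fun hle => ht.not_ge (le_csSup hbdd hle)
  have hs0 : clip v s = 0 := by
    refine le_antisymm hsS ?_
    have h1 : Tendsto (clip v) (𝓝[>] s) (𝓝 (clip v s)) :=
      hcont.continuousAt.tendsto.mono_left nhdsWithin_le_nhds
    exact ge_of_tendsto h1 (eventually_mem_nhdsWithin.mono fun t ht => (hpos t ht).le)
  refine ⟨fun t => clip v (t + (⌊s / T⌋ : ℤ) * T), memX1_comp_add_const hc _,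
    fun t => clip_mem_Icc v _, ?_, s - ⌊s / T⌋ * T, ⟨?_, ?_⟩, ?_, fun t ht => ?_⟩
  · rw [LaE_comp_add_mul_period hper]
    exact LaE_clip_le a hW hv.1.continuous
  · have := (le_div_iff₀ hT).mp (Int.floor_le (s / T))
    linarith
  · have := (div_lt_iff₀ hT).mp (Int.lt_floor_add_one (s / T))
    linarith
  · simpa using hs0
  · exact hpos _ (by linarith)

/-- Existence of a minimizer by the direct method. -/
lemma exists_isMinimizer {a W : ℝ → ℝ} {a₁ a₂ T : ℝ} (hW : DoubleWell W) (hma : Measurable a)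
    (ha₁ : 0 < a₁) (ha : ∀ t, a₁ ≤ a t ∧ a t ≤ a₂) (hT : 0 < T) (hper : Function.Periodic a T) :
    ∃ u, memX1 u ∧ (∀ t, u t ∈ Icc (-1 : ℝ) 1) ∧ LaE a W u ≠ ∞ ∧
      ∀ v, memX1 v → LaE a W u ≤ LaE a W v := by
  have ha0 : ∀ t, 0 ≤ a t := fun t => ha₁.le.trans (ha t).1
  have ha₂ : 0 ≤ a₂ := (ha0 0).trans (ha 0).2
  obtain ⟨v₀, hv₀, hv₀fin⟩ := exists_memX1_LaE_ne_top ha₂ (fun t => (ha t).2) hW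
  obtain ⟨m, hm⟩ : ∃ m, m = sInf (LaE a W '' {v | memX1 v}) := ⟨_, rfl⟩
  have hmle : ∀ v, memX1 v → m ≤ LaE a W v := fun v hv => hm ▸ sInf_le ⟨v, hv, rfl⟩
  have hmfin : m ≠ ∞ := ne_top_of_le_ne_top hv₀fin (hmle v₀ hv₀)
  obtain ⟨e, -, he, hemem⟩ := exists_seq_tendsto_sInf (S := LaE a W '' {v | memX1 v})
    ⟨_, v₀, hv₀, rfl⟩ (OrderBot.bddBelow _)
  choose w₀ hw₀ hw₀e using hemem
  choose w hw hwI hwle s hs hws hwpos using fun n =>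
    exists_normalized_competitor hT hper hW (hw₀ n)
  obtain ⟨u, φ, hφ, hlim⟩ := exists_subseq_tendsto_of_lipschitzWith (fun n => (hw n).1) hwI
  have hu : LipschitzWith 1 u := lipschitzWith_of_tendsto (fun n => (hw (φ n)).1) hlim
  have huI : ∀ t, u t ∈ Icc (-1 : ℝ) 1 := fun t =>
    isClosed_Icc.mem_of_tendsto (hlim t) (Eventually.of_forall fun n => hwI (φ n) t)
  have hLlim : Tendsto (fun n => LaE a W (w (φ n))) atTop (𝓝 m) := by
    refine (tendsto_of_tendsto_of_tendsto_of_le_of_le tendsto_const_nhds (hm ▸ he)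
      (fun n => hmle _ (hw n)) fun n => ?_).comp hφ.tendsto_atTop
    exact (hwle n).trans (hw₀e n).le
  have hum : LaE a W u ≤ m := by
    rw [← hLlim.liminf_eq]
    exact LaE_le_liminf hma ha0 hW.1.continuous hW.nonneg (fun n => (hw (φ n)).1) hu hlim
  have hufin : LaE a W u ≠ ∞ := ne_top_of_le_ne_top hmfin hum
  have hnear := fun {ε : ℝ} (hε : 0 < ε) =>
    exists_forall_lt_abs ha₁ (fun t => (ha t).1) hW hu hufin hε
  have htop : Tendsto u atTop (𝓝 1) := by
    rw [Metric.tendsto_atTop]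
    intro ε hε
    obtain ⟨R, hR⟩ := hnear hε
    refine ⟨max (T + 1) (R + 1), fun t ht => ?_⟩
    have h1 : T + 1 ≤ t := (le_max_left _ _).trans ht
    have h2 : R + 1 ≤ t := (le_max_right _ _).trans ht
    have h3 : 0 ≤ u t := ge_of_tendsto (hlim t) (Eventually.of_forall fun n =>
      (hwpos (φ n) t (by linarith [(hs (φ n)).2])).le)
    have h4 := hR t (by linarith [le_abs_self t])
    rw [abs_of_nonneg h3] at h4
    rw [Real.dist_eq, abs_lt]
    constructor <;> linarith [(huI t).2]
  have hgap : ∃ δ > 0, ∀ t < -1, u t ≤ 1 - δ := by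
    obtain ⟨M, hM0, hM⟩ := exists_forall_le_of_continuous hW.1.continuous 1
    obtain ⟨c, hc, hlow⟩ := exists_pos_le_setLIntegral ha₁ (fun t => (ha t).1) hW
      (show (0 : ℝ) < 1 / 4 by norm_num)
    set C := 1 + a₂ * M with hC
    have hCpos : 0 < C := by positivity
    refine ⟨c / (2 * C), by positivity, fun τ hτ => ?_⟩
    by_contra! hcon
    have hc2 : m < m + ENNReal.ofReal (c / 2) :=
      ENNReal.lt_add_right hmfin (ENNReal.ofReal_pos.mpr (half_pos hc)).ne'
    obtain ⟨n, hn1, hn2⟩ := (((hlim τ).eventually (lt_mem_nhds hcon)).and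
      (hLlim.eventually (gt_mem_nhds hc2))).exists
    set f := w (φ n) with hf
    have hfX : memX1 f := hw (φ n)
    have hcomp := hmle _ (memX1_glueAt (c := τ) hfX.1 hfX.2.2 (lipschitzWith_rampUp τ (f τ))
      (tendsto_rampUp τ (f τ)) (by simp [rampUp, (hwI (φ n) τ).2, hf]))
    rw [LaE_glueAt] at hcomp
    have hramp := setLIntegral_rampUp_le (c := τ) ha₂ (fun t => (ha t).2) hW
      (fun s hs => (le_abs_self _).trans (hM s hs)) (hwI (φ n) τ)
    have hramp2 : ENNReal.ofReal (1 + a₂ * M) * ENNReal.ofReal (1 - f τ)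
        ≤ ENNReal.ofReal (c / 2) := by
      rw [← ENNReal.ofReal_mul hCpos.le]
      refine ENNReal.ofReal_le_ofReal ?_
      calc C * (1 - f τ) ≤ C * (c / (2 * C)) := by gcongr; linarith
        _ = c / 2 := by field_simp
    have hcost : ENNReal.ofReal c ≤ ∫⁻ t in Ioi τ, actionDensity a W f t := by
      refine (hlow f hfX.1 (s (φ n)) ?_).trans (lintegral_mono_set fun t ht => ?_)
      · rw [hf, hws]; norm_num
      · simp only [mem_Ioi]
        linarith [ht.1, (hs (φ n)).1]
    have hsplit := LaE_eq_Iic_add_Ioi a W f τ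
    have h1 : m + ENNReal.ofReal c ≤ LaE a W f + ENNReal.ofReal (c / 2) := by
      calc m + ENNReal.ofReal c
          ≤ ((∫⁻ t in Iic τ, actionDensity a W f t) + ENNReal.ofReal (c / 2))
            + ∫⁻ t in Ioi τ, actionDensity a W f t := by
              refine add_le_add (hcomp.trans ?_) hcost
              gcongr
              exact hramp.trans hramp2
        _ = LaE a W f + ENNReal.ofReal (c / 2) := by rw [hsplit]; ring
    have h2 : LaE a W f + ENNReal.ofReal (c / 2)
        < m + ENNReal.ofReal (c / 2) + ENNReal.ofReal (c / 2) :=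
      ENNReal.add_lt_add_right ENNReal.ofReal_ne_top hn2
    rw [add_assoc, ← ENNReal.ofReal_add (half_pos hc).le (half_pos hc).le, add_halves] at h2
    exact h1.not_gt h2
  have hbot : Tendsto u atBot (𝓝 (-1)) := by
    obtain ⟨δ, hδ, hgap⟩ := hgap
    rw [Metric.tendsto_nhds]
    intro ε hε
    obtain ⟨R, hR⟩ := hnear (lt_min hε hδ)
    filter_upwards [Iic_mem_atBot (min (-2) (-(R + 1)))] with t ht
    have h1 : t ≤ -2 := (mem_Iic.mp ht).trans (min_le_left _ _)
    have h2 : t ≤ -(R + 1) := (mem_Iic.mp ht).trans (min_le_right _ _)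
    have h3 := hgap t (by linarith)
    have h4 := hR t (by linarith [neg_le_abs t])
    have h5 := min_le_left ε δ
    have h6 := min_le_right ε δ
    rw [Real.dist_eq, abs_lt]
    rcases lt_abs.mp h4 with h | h <;> constructor <;> linarith [(huI t).1]
  have huX : memX1 u := ⟨hu, htop, hbot⟩
  exact ⟨u, huX, huI, hufin, fun v hv => hum.trans (hmle v hv)⟩

lemma intervalIntegrable_of_bounded {f : ℝ → ℝ} (hf : Measurable f) {C : ℝ}
    (hC : ∀ t, |f t| ≤ C) (α β : ℝ) : IntervalIntegrable f volume α β :=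
  (intervalIntegrable_const (c := C)).mono_fun hf.aestronglyMeasurable
    (Eventually.of_forall fun t => (hC t).trans (le_abs_self C))

lemma intervalIntegrable_kinetic_deriv (u : ℝ → ℝ) (α β : ℝ) :
    IntervalIntegrable (fun t => kinetic (deriv u t)) volume α β :=
  intervalIntegrable_of_bounded (continuous_kinetic.measurable.comp (measurable_deriv u)) (C := 1)
    (fun t => by rw [Function.comp_apply, abs_of_nonneg (kinetic_nonneg _)]
                 exact kinetic_le_one _) α β

lemma ofReal_integral_eq_setLIntegral_actionDensity {a W u : ℝ → ℝ} (hma : Measurable a) {A : ℝ}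
    (ha : ∀ t, 0 ≤ a t ∧ a t ≤ A) (hWc : Continuous W) (hW : ∀ s, 0 ≤ W s) (hu : Continuous u)
    {α β : ℝ} (hαβ : α ≤ β) :
    ENNReal.ofReal (∫ t in α..β, (kinetic (deriv u t) + a t * W (u t)))
      = ∫⁻ t in Ioc α β, actionDensity a W u t := by
  have haint : IntervalIntegrable a volume α β :=
    intervalIntegrable_of_bounded hma (C := A) (fun t => by
      rw [abs_of_nonneg (ha t).1]; exact (ha t).2) α β
  have hint := (intervalIntegrable_kinetic_deriv u α β).add
    (haint.mul_continuousOn (hWc.comp hu).continuousOn)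
  rw [intervalIntegral.integral_of_le hαβ]
  exact ofReal_integral_eq_lintegral_ofReal
    ((intervalIntegrable_iff_integrableOn_Ioc_of_le hαβ).mp hint)
    (Eventually.of_forall fun t => add_nonneg (kinetic_nonneg _) (mul_nonneg (ha t).1 (hW _)))

lemma lipschitzWith_convexComb {u w : ℝ → ℝ} (hu : LipschitzWith 1 u) (hw : LipschitzWith 1 w)
    {l : ℝ} (hl0 : 0 ≤ l) (hl1 : l ≤ 1) : LipschitzWith 1 fun t => (1 - l) * u t + l * w t := by
  refine LipschitzWith.of_dist_le_mul fun s t => ?_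
  have h1 := hu.abs_sub_le_of_one t s
  have h2 := hw.abs_sub_le_of_one t s
  simp only [NNReal.coe_one, one_mul, Real.dist_eq]
  calc |(1 - l) * u s + l * w s - ((1 - l) * u t + l * w t)|
      = |(1 - l) * (u s - u t) + l * (w s - w t)| := by ring_nf
    _ ≤ (1 - l) * |u s - u t| + l * |w s - w t| := by
        refine (abs_add_le _ _).trans_eq ?_
        rw [abs_mul, abs_mul, abs_of_nonneg hl0, abs_of_nonneg (sub_nonneg.mpr hl1)]
    _ ≤ (1 - l) * |s - t| + l * |s - t| := by gcongr
    _ = |s - t| := by ring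

/-- Comparing a minimizer with a convex combination, before passing to the limit. -/
lemma integral_kinetic_sub_le_slope {a W u w : ℝ → ℝ} (hma : Measurable a) {A : ℝ}
    (ha : ∀ t, 0 ≤ a t ∧ a t ≤ A) (hWc : Continuous W) (hW : ∀ s, 0 ≤ W s) (hu : memX1 u)
    (hmin : ∀ v, memX1 v → LaE a W u ≤ LaE a W v) (hfin : LaE a W u ≠ ∞)
    (hw : LipschitzWith 1 w) {α β : ℝ} (hαβ : α ≤ β) (hα : w α = u α) (hβ : w β = u β)
    {l : ℝ} (hl0 : 0 < l) (hl1 : l ≤ 1) :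
    ∫ t in α..β, (kinetic (deriv u t) - kinetic (deriv w t))
      ≤ ∫ t in α..β, a t * (l⁻¹ * (W ((1 - l) * u t + l * w t) - W (u t))) := by
  set z : ℝ → ℝ := fun t => (1 - l) * u t + l * w t with hz
  have hzL : LipschitzWith 1 z := lipschitzWith_convexComb hu.1 hw hl0.le hl1
  have haint : IntervalIntegrable a volume α β :=
    intervalIntegrable_of_bounded hma (C := A) (fun t => by
      rw [abs_of_nonneg (ha t).1]; exact (ha t).2) α β
  have hpot : ∀ {v : ℝ → ℝ}, Continuous v →
      IntervalIntegrable (fun t => a t * W (v t)) volume α β := fun hv =>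
    haint.mul_continuousOn (hWc.comp hv).continuousOn
  have hku := intervalIntegrable_kinetic_deriv u α β
  have hkw := intervalIntegrable_kinetic_deriv w α β
  have hkz := intervalIntegrable_kinetic_deriv z α β
  have hpu := hpot hu.1.continuous
  have hpz := hpot hzL.continuous
  have hle := setLIntegral_Ioc_le_of_isMinimizer hu hmin hfin hzL hαβ
    (by simp only [hz, hα]; ring) (by simp only [hz, hβ]; ring)
  rw [← ofReal_integral_eq_setLIntegral_actionDensity hma ha hWc hW hu.1.continuous hαβ,
    ← ofReal_integral_eq_setLIntegral_actionDensity hma ha hWc hW hzL.continuous hαβ,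
    ENNReal.ofReal_le_ofReal_iff (intervalIntegral.integral_nonneg hαβ fun t _ =>
      add_nonneg (kinetic_nonneg _) (mul_nonneg (ha t).1 (hW _))),
    intervalIntegral.integral_add hku hpu, intervalIntegral.integral_add hkz hpz] at hle
  have hconv : ∫ t in α..β, kinetic (deriv z t)
      ≤ ∫ t in α..β, ((1 - l) * kinetic (deriv u t) + l * kinetic (deriv w t)) := by
    refine intervalIntegral.integral_mono_ae hαβ hkz
      ((hku.const_mul _).add (hkw.const_mul _)) ?_
    filter_upwards [hu.1.ae_differentiableAt_real, hw.ae_differentiableAt_real] with t h1 h2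
    have hd : deriv z t = (1 - l) * deriv u t + l * deriv w t :=
      ((h1.hasDerivAt.const_mul _).add (h2.hasDerivAt.const_mul _)).deriv
    rw [hd]
    exact convexOn_kinetic.2 (abs_le.mp (abs_deriv_le_one hu.1 t))
      (abs_le.mp (abs_deriv_le_one hw t)) (by linarith) hl0.le (by ring)
  rw [intervalIntegral.integral_add (hku.const_mul _) (hkw.const_mul _),
    intervalIntegral.integral_const_mul, intervalIntegral.integral_const_mul] at hconv
  have hrhs : ∫ t in α..β, a t * (l⁻¹ * (W (z t) - W (u t)))
      = l⁻¹ * ((∫ t in α..β, a t * W (z t)) - ∫ t in α..β, a t * W (u t)) := by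
    rw [← intervalIntegral.integral_sub hpz hpu, ← intervalIntegral.integral_const_mul]
    congr 1
    ext t
    ring
  rw [hrhs, intervalIntegral.integral_sub hku hkw, inv_mul_eq_div, le_div_iff₀ hl0]
  linarith

/-- The variational inequality satisfied by a minimizer. -/
lemma integral_kinetic_sub_le {a W u w : ℝ → ℝ} (hma : Measurable a) {A : ℝ}
    (ha : ∀ t, 0 ≤ a t ∧ a t ≤ A) (hWc : ContDiff ℝ 1 W) (hW : ∀ s, 0 ≤ W s) (hu : memX1 u)
    (hmin : ∀ v, memX1 v → LaE a W u ≤ LaE a W v) (hfin : LaE a W u ≠ ∞)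
    (hw : LipschitzWith 1 w) {α β : ℝ} (hαβ : α ≤ β) (hα : w α = u α) (hβ : w β = u β) :
    ∫ t in α..β, (kinetic (deriv u t) - kinetic (deriv w t))
      ≤ ∫ t in α..β, a t * (deriv W (u t) * (w t - u t)) := by
  have hW1 : Differentiable ℝ W := hWc.differentiable one_ne_zero
  set R := |u α| + (β - α) with hR
  have hbd : ∀ {v : ℝ → ℝ}, LipschitzWith 1 v → v α = u α → ∀ t ∈ Icc α β, v t ∈ Icc (-R) R := by
    intro v hv hvα t ht
    have h1 := hv.abs_sub_le_of_one α t
    rw [abs_of_nonneg (sub_nonneg.mpr ht.1), hvα] at h1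
    have h2 := abs_sub_abs_le_abs_sub (v t) (u α)
    exact abs_le.mp (by linarith [ht.2])
  obtain ⟨C, hC0, hC⟩ := exists_forall_le_of_continuous (hWc.continuous_deriv le_rfl) R
  have hWlip : ∀ x ∈ Icc (-R) R, ∀ y ∈ Icc (-R) R, |W y - W x| ≤ C * |y - x| :=
    fun x hx y hy => Convex.norm_image_sub_le_of_norm_deriv_le
      (fun s _ => hW1 s) hC (convex_Icc _ _) hx hy
  have hA : 0 ≤ A := (ha 0).1.trans (ha 0).2
  set l : ℕ → ℝ := fun n => 1 / ((n : ℝ) + 1) with hl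
  have hl0 : ∀ n, 0 < l n := fun n => Nat.one_div_pos_of_nat
  have hl1 : ∀ n, l n ≤ 1 := fun n => by
    rw [hl]
    exact div_le_one_of_le₀ (by linarith [n.cast_nonneg (α := ℝ)]) (by positivity)
  have hl' : Tendsto l atTop (𝓝[≠] 0) :=
    tendsto_nhdsWithin_iff.mpr ⟨tendsto_one_div_add_atTop_nhds_zero_nat,
      Eventually.of_forall fun n => (hl0 n).ne'⟩
  have hWm := hWc.continuous
  have hlim : Tendsto (fun n => ∫ t in α..β,
      a t * ((l n)⁻¹ * (W ((1 - l n) * u t + l n * w t) - W (u t)))) atTop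
      (𝓝 (∫ t in α..β, a t * (deriv W (u t) * (w t - u t)))) := by
    refine intervalIntegral.tendsto_integral_filter_of_dominated_convergence
      (fun _ => A * (C * (2 * R))) (Eventually.of_forall fun n => ?_)
      (Eventually.of_forall fun n => Eventually.of_forall fun t ht => ?_)
      intervalIntegrable_const (Eventually.of_forall fun t ht => ?_)
    · have h1 := hu.1.continuous
      have h2 := hw.continuous
      have h3 : Continuous fun t => (l n)⁻¹ * (W ((1 - l n) * u t + l n * w t) - W (u t)) := by
        fun_prop
      exact (hma.mul h3.measurable).aestronglyMeasurable
    · rw [uIoc_of_le hαβ] at ht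
      have ht' : t ∈ Icc α β := ⟨ht.1.le, ht.2⟩
      have hzL := lipschitzWith_convexComb hu.1 hw (hl0 n).le (hl1 n)
      have h1 := hbd hu.1 rfl t ht'
      have h2 := hbd hw hα t ht'
      have h3 := hbd hzL (by rw [hα]; ring) t ht'
      have h4 := hWlip _ h1 _ h3
      have h5 : (1 - l n) * u t + l n * w t - u t = l n * (w t - u t) := by ring
      rw [h5, abs_mul, abs_of_pos (hl0 n)] at h4
      have h6 : |w t - u t| ≤ 2 * R := by
        rw [abs_le]; constructor <;> linarith [h1.1, h1.2, h2.1, h2.2]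
      rw [Real.norm_eq_abs, abs_mul, abs_mul, abs_of_nonneg (ha t).1,
        abs_of_pos (inv_pos.mpr (hl0 n))]
      refine mul_le_mul (ha t).2 ?_ (by have := hl0 n; positivity) hA
      rw [inv_mul_eq_div, div_le_iff₀ (hl0 n)]
      calc _ ≤ C * (l n * |w t - u t|) := h4
        _ ≤ C * (l n * (2 * R)) := by have := hl0 n; gcongr
        _ = C * (2 * R) * l n := by ring
    · refine Tendsto.const_mul _ ?_
      have hd : HasDerivAt (fun s : ℝ => W (u t + s * (w t - u t)))
          (deriv W (u t) * (w t - u t)) 0 := by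
        have hin : HasDerivAt (fun s : ℝ => u t + s * (w t - u t)) (w t - u t) 0 := by
          simpa using ((hasDerivAt_id (0 : ℝ)).mul_const (w t - u t)).const_add (u t)
        refine HasDerivAt.comp (0 : ℝ) (h₂ := W) ?_ hin
        simpa using (hW1 (u t)).hasDerivAt
      have h1 := (hasDerivAt_iff_tendsto_slope_zero.mp hd).comp hl'
      refine h1.congr fun n => ?_
      simp only [Function.comp_apply, zero_add, zero_mul, add_zero, smul_eq_mul]
      congr 3
      ring
  exact ge_of_tendsto hlim (Eventually.of_forall fun n =>
    integral_kinetic_sub_le_slope hma ha hWm hW hu hmin hfin hw hαβ hα hβ (hl0 n) (hl1 n))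

lemma velocity_injective : Function.Injective velocity := fun x y h => by
  rw [← velocity_div_sqrt x, h, velocity_div_sqrt]

section Momentum

variable {g : ℝ → ℝ} {M : ℝ}

lemma lipschitzWith_momentum (hg : Measurable g) (hM : ∀ t, |g t| ≤ M) (c : ℝ) :
    LipschitzWith M.toNNReal fun t => c + ∫ r in (0 : ℝ)..t, g r := by
  have hM0 : 0 ≤ M := (abs_nonneg _).trans (hM 0)
  refine LipschitzWith.of_dist_le_mul fun s t => ?_
  rw [Real.coe_toNNReal _ hM0, Real.dist_eq, Real.dist_eq, add_sub_add_left_eq_sub,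
    intervalIntegral.integral_interval_sub_left (intervalIntegrable_of_bounded hg hM _ _)
      (intervalIntegrable_of_bounded hg hM _ _)]
  simpa only [Real.norm_eq_abs] using
    intervalIntegral.norm_integral_le_of_norm_le_const (f := g) (a := t) (b := s) (C := M)
      fun x _ => hM x

lemma ae_deriv_momentum (hg : Measurable g) (hM : ∀ t, |g t| ≤ M) (c : ℝ) :
    ∀ᵐ t, deriv (fun t => c + ∫ r in (0 : ℝ)..t, g r) t = g t := by
  have hloc : LocallyIntegrable g volume := by
    intro x
    refine ⟨Icc (x - 1) (x + 1), Icc_mem_nhds (by linarith) (by linarith), ?_⟩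
    exact (intervalIntegrable_iff_integrableOn_Icc_of_le (by linarith)).mp
      (intervalIntegrable_of_bounded hg hM _ _)
  filter_upwards [_root_.LocallyIntegrable.ae_hasDerivAt_integral hloc] with t ht
  exact ((ht 0).const_add c).deriv

/-- Integration by parts against the momentum. -/
lemma integral_momentum_mul_deriv_sub (hg : Measurable g) (hM : ∀ t, |g t| ≤ M) (c : ℝ)
    {u w : ℝ → ℝ} (hu : LipschitzWith 1 u) (hw : LipschitzWith 1 w) {α β : ℝ}
    (hα : w α = u α) (hβ : w β = u β) :
    ∫ t in α..β, (c + ∫ r in (0 : ℝ)..t, g r) * (deriv u t - deriv w t)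
      = ∫ t in α..β, g t * (w t - u t) := by
  have h := (absolutelyContinuousOnInterval_of_lipschitzWith
    (lipschitzWith_momentum hg hM c) α β).integral_mul_deriv_eq_deriv_mul
    (absolutelyContinuousOnInterval_of_lipschitzWith (hu.sub hw) α β)
  simp only [hα, hβ, sub_self, mul_zero, zero_sub] at h
  have h1 : ∫ t in α..β, (c + ∫ r in (0 : ℝ)..t, g r) * deriv (fun t => u t - w t) t
      = ∫ t in α..β, (c + ∫ r in (0 : ℝ)..t, g r) * (deriv u t - deriv w t) := by
    refine intervalIntegral.integral_congr_ae ?_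
    filter_upwards [hu.ae_differentiableAt_real, hw.ae_differentiableAt_real] with t h1 h2 _
    rw [deriv_fun_sub h1 h2]
  have h2 : ∫ t in α..β, deriv (fun t => c + ∫ r in (0 : ℝ)..t, g r) t * (u t - w t)
      = ∫ t in α..β, g t * (u t - w t) := by
    refine intervalIntegral.integral_congr_ae ?_
    filter_upwards [ae_deriv_momentum hg hM c] with t h1 _
    rw [h1]
  rw [← h1, h, h2, ← intervalIntegral.integral_neg]
  congr 1
  ext t
  ring

/-- The boundary value problem for the linearised functional is solvable on long intervals. -/
lemma exists_integral_velocity_eq (hg : Measurable g) (hM : ∀ t, |g t| ≤ M) {α β y : ℝ}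
    (hαβ : 4 ≤ β - α) (hy : |y| ≤ 2) :
    ∃ c, ∫ t in α..β, velocity (c + ∫ r in (0 : ℝ)..t, g r) = y := by
  have hG : Continuous fun t => ∫ r in (0 : ℝ)..t, g r := by
    simpa using (lipschitzWith_momentum hg hM 0).continuous
  have hle : α ≤ β := by linarith
  have hv := continuous_velocity
  have hint : ∀ c, IntervalIntegrable (fun t => velocity (c + ∫ r in (0 : ℝ)..t, g r))
      volume α β := fun c => Continuous.intervalIntegrable (by fun_prop) _ _
  have hcont : Continuous fun c => ∫ t in α..β, velocity (c + ∫ r in (0 : ℝ)..t, g r) :=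
    intervalIntegral.continuous_parametric_intervalIntegral_of_continuous' (by fun_prop) _ _
  obtain ⟨K, hK⟩ := isCompact_Icc.exists_bound_of_continuousOn (hG.continuousOn (s := Icc α β))
  have hy := abs_le.mp hy
  refine mem_range_of_exists_le_of_exists_ge hcont ⟨-(K + 1), ?_⟩ ⟨K + 1, ?_⟩
  · have h := intervalIntegral.integral_mono_on hle (hint (-(K + 1)))
      (intervalIntegrable_const (c := velocity (-1))) fun t ht => velocity_monotone (by
        linarith [(abs_le.mp (hK t ht)).2])
    rw [intervalIntegral.integral_const, smul_eq_mul, velocity_neg] at h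
    nlinarith [one_half_le_velocity_one]
  · have h := intervalIntegral.integral_mono_on hle
      (intervalIntegrable_const (c := velocity 1)) (hint (K + 1)) fun t ht => velocity_monotone (by
        linarith [(abs_le.mp (hK t ht)).1])
    rw [intervalIntegral.integral_const, smul_eq_mul] at h
    nlinarith [one_half_le_velocity_one]

end Momentum

/-- On long intervals a minimizer coincides with the explicit solution of the boundary value
problem. -/
lemma exists_eq_add_integral_velocity {a W u : ℝ → ℝ} (hma : Measurable a) {A M : ℝ}
    (ha : ∀ t, 0 ≤ a t ∧ a t ≤ A) (hWc : ContDiff ℝ 1 W) (hW : ∀ s, 0 ≤ W s) (hu : memX1 u)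
    (huI : ∀ t, u t ∈ Icc (-1 : ℝ) 1)
    (hmin : ∀ v, memX1 v → LaE a W u ≤ LaE a W v) (hfin : LaE a W u ≠ ∞)
    (hM : ∀ t, |a t * deriv W (u t)| ≤ M) {α β : ℝ} (hαβ : 4 ≤ β - α) :
    ∃ c, ∀ t ∈ Icc α β, u t
      = u α + ∫ s in α..t, velocity (c + ∫ r in (0 : ℝ)..s, a r * deriv W (u r)) := by
  have hle : α ≤ β := by linarith
  have hg : Measurable fun t => a t * deriv W (u t) :=
    hma.mul ((hWc.continuous_deriv le_rfl).comp hu.1.continuous).measurable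
  obtain ⟨c, hc⟩ := exists_integral_velocity_eq hg hM hαβ (y := u β - u α) (by
    rw [abs_le]; constructor <;> linarith [(huI α).1, (huI α).2, (huI β).1, (huI β).2])
  refine ⟨c, ?_⟩
  set P : ℝ → ℝ := fun t => c + ∫ r in (0 : ℝ)..t, a r * deriv W (u r) with hP
  have hPc : Continuous P := (lipschitzWith_momentum hg hM c).continuous
  have hvP : Continuous fun t => velocity (P t) := continuous_velocity.comp hPc
  set w : ℝ → ℝ := fun t => u α + ∫ s in α..t, velocity (P s) with hw
  have hwd : ∀ t, HasDerivAt w (velocity (P t)) t := fun t =>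
    (hvP.integral_hasStrictDerivAt α t).hasDerivAt.const_add _
  have hwL : LipschitzWith 1 w := by
    refine lipschitzWith_of_nnnorm_deriv_le (fun t => (hwd t).differentiableAt) fun t => ?_
    rw [(hwd t).deriv, ← NNReal.coe_le_coe, coe_nnnorm]
    exact (abs_velocity_lt_one _).le
  have hwα : w α = u α := by simp [hw]
  have hwβ : w β = u β := by simp only [hw]; linarith
  have hvar := integral_kinetic_sub_le hma ha hWc hW hu hmin hfin hwL hle hwα hwβ
  have hparts := integral_momentum_mul_deriv_sub hg hM c hu.1 hwL hwα hwβ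
  have hPu : IntervalIntegrable (fun t => P t * (deriv u t - deriv w t)) volume α β :=
    IntervalIntegrable.continuousOn_mul
      ((intervalIntegrable_of_bounded (measurable_deriv u) (abs_deriv_le_one hu.1) _ _).sub
        (intervalIntegrable_of_bounded (measurable_deriv w) (abs_deriv_le_one hwL) _ _))
      hPc.continuousOn
  have hk := (intervalIntegrable_kinetic_deriv u α β).sub (intervalIntegrable_kinetic_deriv w α β)
  set D : ℝ → ℝ := fun t =>
    kinetic (deriv u t) - kinetic (deriv w t) - P t * (deriv u t - deriv w t) with hD
  have hDint : IntervalIntegrable D volume α β := hk.sub hPu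
  have hDnn : ∀ t, 0 ≤ D t := fun t => by
    have := kinetic_velocity_add_le (P t) (deriv u t) (abs_deriv_le_one hu.1 t)
    simp only [hD, (hwd t).deriv]
    linarith
  have hDle : ∫ t in α..β, D t ≤ 0 := by
    have h1 : ∫ t in α..β, D t = (∫ t in α..β, (kinetic (deriv u t) - kinetic (deriv w t)))
        - ∫ t in α..β, P t * (deriv u t - deriv w t) := intervalIntegral.integral_sub hk hPu
    have h2 : ∫ t in α..β, a t * deriv W (u t) * (w t - u t)
        = ∫ t in α..β, a t * (deriv W (u t) * (w t - u t)) := by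
      simp only [mul_assoc]
    linarith
  have hD0 := (intervalIntegral.integral_eq_zero_iff_of_le_of_nonneg_ae hle
    (Eventually.of_forall hDnn) hDint).mp
    (hDle.antisymm (intervalIntegral.integral_nonneg hle fun t _ => hDnn t))
  rw [Filter.EventuallyEq, ae_restrict_iff' measurableSet_Ioc] at hD0
  intro t ht
  have hcongr : ∫ s in α..t, deriv u s = ∫ s in α..t, velocity (P s) := by
    refine intervalIntegral.integral_congr_ae ?_
    filter_upwards [hD0] with s hs hst
    rw [uIoc_of_le ht.1] at hst
    have h := hs ⟨hst.1, hst.2.trans ht.2⟩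
    simp only [hD, (hwd s).deriv, Pi.zero_apply] at h
    exact eq_velocity_of_kinetic_eq _ _ (abs_deriv_le_one hu.1 s) (by linarith)
  rw [← hcongr, integral_deriv_of_lipschitzWith hu.1]
  ring

/-- A minimizer is everywhere differentiable, with momentum an antiderivative of the force. -/
lemma exists_hasDerivAt_velocity {a W u : ℝ → ℝ} (hma : Measurable a) {A M : ℝ}
    (ha : ∀ t, 0 ≤ a t ∧ a t ≤ A) (hWc : ContDiff ℝ 1 W) (hW : ∀ s, 0 ≤ W s) (hu : memX1 u)
    (huI : ∀ t, u t ∈ Icc (-1 : ℝ) 1)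
    (hmin : ∀ v, memX1 v → LaE a W u ≤ LaE a W v) (hfin : LaE a W u ≠ ∞)
    (hM : ∀ t, |a t * deriv W (u t)| ≤ M) :
    ∃ c, ∀ t, HasDerivAt u (velocity (c + ∫ r in (0 : ℝ)..t, a r * deriv W (u r))) t := by
  have hg : Measurable fun t => a t * deriv W (u t) :=
    hma.mul ((hWc.continuous_deriv le_rfl).comp hu.1.continuous).measurable
  have hloc : ∀ R : ℝ, 2 ≤ R → ∃ c, ∀ t ∈ Ioo (-R) R,
      HasDerivAt u (velocity (c + ∫ r in (0 : ℝ)..t, a r * deriv W (u r))) t := fun R hR => by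
    obtain ⟨c, hc⟩ := exists_eq_add_integral_velocity hma ha hWc hW hu huI hmin hfin hM
      (α := -R) (β := R) (by linarith)
    refine ⟨c, fun t ht => ?_⟩
    have hd := ((continuous_velocity.comp (lipschitzWith_momentum hg hM c).continuous
      ).integral_hasStrictDerivAt (-R) t).hasDerivAt.const_add (u (-R))
    refine hd.congr_of_eventuallyEq ?_
    filter_upwards [Icc_mem_nhds ht.1 ht.2] with s hs
    exact hc s hs
  obtain ⟨c, hc⟩ := hloc 2 le_rfl
  refine ⟨c, fun t => ?_⟩
  obtain ⟨c', hc'⟩ := hloc (|t| + 2) (by linarith [abs_nonneg t])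
  have h := (hc 0 (by norm_num)).unique (hc' 0 ⟨by linarith [abs_nonneg t], by
    linarith [abs_nonneg t]⟩)
  simp only [intervalIntegral.integral_same, add_zero] at h
  rw [velocity_injective h]
  exact hc' t ⟨by linarith [neg_abs_le t], by linarith [le_abs_self t]⟩

/-- A function converging along a translation-invariant filter, with Lipschitz derivative, has
derivative tending to zero. -/
lemma tendsto_deriv_zero {u v : ℝ → ℝ} {K : NNReal} (hd : ∀ t, HasDerivAt u (v t) t)
    (hv : LipschitzWith K v) {F : Filter ℝ} (hF : ∀ h, Tendsto (fun t => t + h) F F) {L : ℝ}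
    (hL : Tendsto u F (𝓝 L)) : Tendsto v F (𝓝 0) := by
  rw [Metric.tendsto_nhds]
  intro ε hε
  have hK := K.coe_nonneg
  set h : ℝ := ε / (2 * (K + 1)) with hh
  have hpos : 0 < h := by positivity
  have hKh : K * h < ε / 2 := by
    rw [hh, mul_div_assoc', div_lt_div_iff₀ (by positivity) (by positivity)]
    nlinarith
  have hdiff : Tendsto (fun t => u (t + h) - u t) F (𝓝 0) := by
    simpa using (hL.comp (hF h)).sub hL
  filter_upwards [(Metric.tendsto_nhds.mp hdiff) (ε / 2 * h) (by positivity)] with t ht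
  obtain ⟨ξ, hξ, hslope⟩ := exists_hasDerivAt_eq_slope u v (lt_add_of_pos_right t hpos)
    (fun s _ => (hd s).continuousAt.continuousWithinAt) (fun s _ => hd s)
  rw [Real.dist_eq, sub_zero] at ht ⊢
  rw [add_sub_cancel_left] at hslope
  have h1 : |v ξ| < ε / 2 := by
    rw [hslope, abs_div, abs_of_pos hpos, div_lt_iff₀ hpos]
    exact ht
  have h2 : |v t - v ξ| ≤ K * h := by
    refine (hv.dist_le_mul t ξ).trans (mul_le_mul_of_nonneg_left ?_ hK)
    rw [Real.dist_eq, abs_le]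
    constructor <;> linarith [hξ.1, hξ.2]
  calc |v t| = |v t - v ξ + v ξ| := by rw [sub_add_cancel]
    _ ≤ |v t - v ξ| + |v ξ| := abs_add_le _ _
    _ < ε := by linarith

/-- A bounded function whose velocity has Lipschitz momentum has bounded momentum. -/
lemma abs_momentum_le {u P : ℝ → ℝ} (hd : ∀ t, HasDerivAt u (velocity (P t)) t)
    (huI : ∀ t, u t ∈ Icc (-1 : ℝ) 1) {K : NNReal} (hP : LipschitzWith K P) (t : ℝ) :
    |P t| ≤ 1 + K * 8 := by
  obtain ⟨ξ, hξ, hslope⟩ := exists_hasDerivAt_eq_slope u (fun t => velocity (P t))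
    (show t < t + 8 by linarith)
    (fun s _ => (hd s).continuousAt.continuousWithinAt) (fun s _ => hd s)
  rw [add_sub_cancel_left] at hslope
  have h8 := huI (t + 8)
  have h0 := huI t
  have hξ1 : |P ξ| ≤ 1 := by
    rw [abs_le]
    constructor
    · by_contra! hlt
      have := velocity_monotone hlt.le
      rw [velocity_neg] at this
      linarith [one_half_le_velocity_one, h8.1, h0.2]
    · by_contra! hlt
      have := velocity_monotone hlt.le
      linarith [one_half_le_velocity_one, h8.2, h0.1]
  have h2 : |P t - P ξ| ≤ K * 8 := by
    refine (hP.dist_le_mul t ξ).trans (mul_le_mul_of_nonneg_left ?_ K.coe_nonneg)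
    rw [Real.dist_eq, abs_le]
    constructor <;> linarith [hξ.1, hξ.2]
  calc |P t| = |P t - P ξ + P ξ| := by rw [sub_add_cancel]
    _ ≤ |P t - P ξ| + |P ξ| := abs_add_le _ _
    _ ≤ 1 + K * 8 := by linarith

/-- For a `T`-periodic weight satisfying `(a₁)`, `L_a` attains its
infimum at some `u_a ∈ X₁`, a `C¹ ∩ W^{2,2}_loc` heteroclinic solution with
`‖u'‖_{L^∞} < 1`. -/
theorem La_attains_infimum_periodic (W a : ℝ → ℝ) (a₁ a₂ T : ℝ)
    (hW : DoubleWell W) (hma : Measurable a)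
    (ha₁ : 0 < a₁) (ha : ∀ t : ℝ, a₁ ≤ a t ∧ a t ≤ a₂)
    (hT : 0 < T) (hper : ∀ t : ℝ, a (t + T) = a t) :
    ∃ u : ℝ → ℝ, memX1 u ∧ (∀ v : ℝ → ℝ, memX1 v → LaE a W u ≤ LaE a W v) ∧
      SolvesEL a W u ∧
      Tendsto u atTop (𝓝 (1:ℝ)) ∧ Tendsto u atBot (𝓝 (-1:ℝ)) ∧
      Tendsto (deriv u) atTop (𝓝 (0:ℝ)) ∧ Tendsto (deriv u) atBot (𝓝 (0:ℝ)) ∧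
      ∃ c : ℝ, c < 1 ∧ ∀ t : ℝ, |deriv u t| ≤ c := by
  obtain ⟨u, hu, huI, hfin, hmin⟩ := exists_isMinimizer hW hma ha₁ ha hT hper
  have ha' : ∀ t, 0 ≤ a t ∧ a t ≤ a₂ := fun t => ⟨ha₁.le.trans (ha t).1, (ha t).2⟩
  have hW' : Continuous (deriv W) := hW.1.continuous_deriv le_rfl
  obtain ⟨C, hC0, hC⟩ := exists_forall_le_of_continuous hW' 1
  have hM : ∀ t, |a t * deriv W (u t)| ≤ a₂ * C := fun t => by
    rw [abs_mul, abs_of_nonneg (ha' t).1]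
    exact mul_le_mul (ha' t).2 (hC _ (huI t)) (abs_nonneg _) ((ha' t).1.trans (ha' t).2)
  have hg : Measurable fun t => a t * deriv W (u t) :=
    hma.mul (hW'.comp hu.1.continuous).measurable
  obtain ⟨c, hd⟩ := exists_hasDerivAt_velocity hma ha' hW.1 hW.nonneg hu huI hmin hfin hM
  set P : ℝ → ℝ := fun t => c + ∫ r in (0 : ℝ)..t, a r * deriv W (u r) with hP
  have hPL : LipschitzWith (a₂ * C).toNNReal P := lipschitzWith_momentum hg hM c
  have hdu : deriv u = fun t => velocity (P t) := funext fun t => (hd t).deriv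
  have hvL : LipschitzWith (1 * (a₂ * C).toNNReal) fun t => velocity (P t) :=
    lipschitzWith_velocity.comp hPL
  refine ⟨u, hu, hmin, ⟨?_, fun s t => ?_⟩, hu.2.1, hu.2.2, ?_, ?_,
    velocity (1 + (a₂ * C).toNNReal * 8), (le_abs_self _).trans_lt (abs_velocity_lt_one _),
    fun t => ?_⟩
  · rw [contDiff_one_iff_deriv, hdu]
    exact ⟨fun t => (hd t).differentiableAt, hvL.continuous⟩
  · simp only [hdu, velocity_div_sqrt]
    simp only [hP]
    rw [add_sub_add_left_eq_sub, intervalIntegral.integral_interval_sub_left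
      (intervalIntegrable_of_bounded hg hM _ _) (intervalIntegrable_of_bounded hg hM _ _)]
  · rw [hdu]
    exact tendsto_deriv_zero hd hvL (fun h => tendsto_atTop_add_const_right _ h tendsto_id) hu.2.1
  · rw [hdu]
    exact tendsto_deriv_zero hd hvL (fun h => tendsto_atBot_add_const_right _ h tendsto_id) hu.2.2
  · have hb := abs_le.mp (abs_momentum_le hd huI hPL t)
    rw [hdu, abs_le, ← velocity_neg]
    exact ⟨velocity_monotone hb.1, velocity_monotone hb.2⟩
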